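/- Let R be a commutative ring and (A, D_G) a 1-tilting cotorsion pair with associated Gabriel topology G. Let M be an R-module with MJ = 0 for some finitely generated J ∈ G, and let 0 → B → A →φ M → 0 be an A-cover of M (that is, φ : A → M is an A-cover with kernel B). Then both A and B are G-torsion modules. -/

import Mathlib

universe u

/-- A Gabriel topology on a commutative ring `R`: a filter of ideals of `R`
satisfying the Gabriel axiom T4. -/
structure GabrielTopology (R : Type u) [CommRing R] : Type u where
  sets : Set (Ideal R)
  top_mem : (⊤ : Ideal R) ∈ sets
  mem_of_le : ∀ {I J : Ideal R}, I ∈ sets → I ≤ J → J ∈ sets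
  inf_mem : ∀ {I J : Ideal R}, I ∈ sets → J ∈ sets → I ⊓ J ∈ sets
  gabriel : ∀ I J : Ideal R, J ∈ sets →
    (∀ r ∈ J, Submodule.colon I (Ideal.span {r}) ∈ sets) → I ∈ sets

namespace GabrielTopology

variable {R : Type u} [CommRing R] (G : GabrielTopology R)

/-- A module `M` is `G`-torsion if the annihilator of every element belongs to `G`. -/
def IsTorsion (M : Type u) [AddCommGroup M] [Module R M] : Prop :=
  ∀ x : M, Ideal.torsionOf R M x ∈ G.sets

/-- A module `M` is `G`-torsion-free if no nonzero element is annihilated by an ideal of `G`. -/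
def IsTorsionFree (M : Type u) [AddCommGroup M] [Module R M] : Prop :=
  ∀ x : M, Ideal.torsionOf R M x ∈ G.sets → x = 0

/-- A module `M` is `G`-divisible if `JM = M` for every `J ∈ G`. -/
def IsDivisible (M : Type u) [AddCommGroup M] [Module R M] : Prop :=
  ∀ J ∈ G.sets, J • (⊤ : Submodule R M) = ⊤

/-- `G` is faithful if `R` is `G`-torsion-free. -/
def Faithful : Prop := ∀ r : R, Ideal.torsionOf R R r ∈ G.sets → r = 0

/-- `G` is finitely generated if it has a basis of finitely generated ideals. -/
def FinitelyGenerated : Prop := ∀ J ∈ G.sets, ∃ J' ∈ G.sets, J' ≤ J ∧ J'.FG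

end GabrielTopology

/-- `Ext¹_R(M, N) = 0`, expressed by the standard characterisation:
every short exact sequence `0 → N → E → M → 0` splits. -/
def Ext1Vanish (R : Type u) [CommRing R] (M N : Type u) [AddCommGroup M] [Module R M]
    [AddCommGroup N] [Module R N] : Prop :=
  ∀ (E : Type u) [AddCommGroup E] [Module R E] (i : N →ₗ[R] E) (p : E →ₗ[R] M),
    Function.Injective i → Function.Surjective p → LinearMap.range i = LinearMap.ker p →
      ∃ s : M →ₗ[R] E, p ∘ₗ s = LinearMap.id

/-- `M` has projective dimension at most 1: the kernel of a free cover is projective. -/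
def ProjDimLE1 (R : Type u) [CommRing R] (M : Type u) [AddCommGroup M] [Module R M] : Prop :=
  ∃ (ι : Type u) (p : (ι →₀ R) →ₗ[R] M),
    Function.Surjective p ∧ Module.Projective R ↥(LinearMap.ker p)

/-- `M ∈ Add(T)`: `M` is a direct summand of a direct sum of copies of `T`. -/
def InAdd (R : Type u) [CommRing R] (T M : Type u) [AddCommGroup T] [Module R T]
    [AddCommGroup M] [Module R M] : Prop :=
  ∃ (ι : Type u) (s : M →ₗ[R] (ι →₀ T)) (r : (ι →₀ T) →ₗ[R] M), r ∘ₗ s = LinearMap.id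

/-- `T` is a 1-tilting module: (T1) `p.dim T ≤ 1`, (T2) `Ext¹(T, T^(κ)) = 0` for all κ,
(T3) there is an exact sequence `0 → R → T₀ → T₁ → 0` with `T₀, T₁ ∈ Add(T)`. -/
def Is1Tilting (R : Type u) [CommRing R] (T : Type u) [AddCommGroup T] [Module R T] : Prop :=
  ProjDimLE1 R T ∧
  (∀ ι : Type u, Ext1Vanish R T (ι →₀ T)) ∧
  ∃ (T0 T1 : ModuleCat.{u} R) (i : R →ₗ[R] ↥T0) (p : ↥T0 →ₗ[R] ↥T1),
    InAdd R T ↥T0 ∧ InAdd R T ↥T1 ∧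
    Function.Injective i ∧ Function.Surjective p ∧ LinearMap.range i = LinearMap.ker p

namespace GabrielTopology

variable {R : Type u} [CommRing R] (G : GabrielTopology R)

/-- `(𝒜, 𝒟_G)` is a 1-tilting cotorsion pair with associated Gabriel topology `G`:
`G` is a faithful finitely generated Gabriel topology and the class of `G`-divisible
modules is the tilting class of a 1-tilting module. -/
def IsTiltingTopology : Prop :=
  G.Faithful ∧ G.FinitelyGenerated ∧
  ∃ T : ModuleCat.{u} R, Is1Tilting R ↥T ∧
    ∀ (M : Type u) [AddCommGroup M] [Module R M], (Ext1Vanish R ↥T M ↔ G.IsDivisible M)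

/-- Membership in the left-hand class `𝒜 = ᗮ(𝒟_G)` of the 1-tilting cotorsion pair. -/
def MemA (M : Type u) [AddCommGroup M] [Module R M] : Prop :=
  ∀ (D : Type u) [AddCommGroup D] [Module R D], G.IsDivisible D → Ext1Vanish R M D

/-- The class `𝒜` is covering: every module has an `𝒜`-cover. -/
def IsACovering : Prop :=
  ∀ (M : Type u) [AddCommGroup M] [Module R M],
    ∃ (C : ModuleCat.{u} R) (φ : ↥C →ₗ[R] M),
      G.MemA ↥C ∧
      (∀ (C' : Type u) [AddCommGroup C'] [Module R C'], G.MemA C' →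
        ∀ f : C' →ₗ[R] M, ∃ g : C' →ₗ[R] ↥C, φ ∘ₗ g = f) ∧
      (∀ e : ↥C →ₗ[R] ↥C, φ ∘ₗ e = φ → Function.Bijective e)

/-- The class `𝒜` is closed under direct limits. -/
def AClosedUnderDirectLimits : Prop :=
  ∀ (ι : Type u) [Preorder ι] [IsDirected ι (· ≤ ·)] [Nonempty ι] [DecidableEq ι]
    (M : ι → Type u) [∀ i, AddCommGroup (M i)] [∀ i, Module R (M i)]
    (f : ∀ i j, i ≤ j → M i →ₗ[R] M j) [DirectedSystem M fun i j h => f i j h],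
    (∀ i, G.MemA (M i)) → G.MemA (Module.DirectLimit M f)

/-- `Q`, via `algebraMap R Q`, is the ring of quotients `R_G` of `R` with respect to `G`:
`Q` is `G`-torsion-free and `G`-injective (i.e. `G`-closed) and the kernel and cokernel
of `R → Q` are `G`-torsion. -/
structure IsRingOfQuotients (Q : Type u) [CommRing Q] [Algebra R Q] : Prop where
  torsionFree : ∀ q : Q, Ideal.torsionOf R Q q ∈ G.sets → q = 0
  gInjective : ∀ J ∈ G.sets, ∀ f : ↥J →ₗ[R] Q, ∃ q : Q, ∀ j : ↥J, f j = (j : R) • q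
  ker_torsion : ∀ r : R, algebraMap R Q r = 0 → Ideal.torsionOf R R r ∈ G.sets
  coker_torsion : ∀ q : Q, ∃ J ∈ G.sets, ∀ x ∈ J, ∃ r : R, x • q = algebraMap R Q r

/-- `G` is a perfect Gabriel topology, realised by the perfect localisation `Q`:
`R → Q` is a flat ring epimorphism and `G = {J ∣ JQ = Q}`. -/
def IsPerfectLocalization (Q : Type u) [CommRing Q] [Algebra R Q] : Prop :=
  Module.Flat R Q ∧
  (∀ (S : Type u) [CommRing S] (f g : Q →+* S),
    f.comp (algebraMap R Q) = g.comp (algebraMap R Q) → f = g) ∧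
  (∀ J : Ideal R, J ∈ G.sets ↔ J • (⊤ : Submodule R Q) = ⊤)

end GabrielTopology

/-- A commutative ring is perfect iff every flat module is projective. -/
def IsPerfectRing (S : Type u) [CommRing S] : Prop :=
  ∀ (M : Type u) [AddCommGroup M] [Module S M], Module.Flat S M → Module.Projective S M

/-- `X` is Σ-pure-split: every pure embedding `A ⊆ B` with `B ∈ Add(X)` splits. -/
def SigmaPureSplit (R : Type u) [CommRing R] (X : Type u) [AddCommGroup X] [Module R X] : Prop :=
  ∀ (A B : Type u) [AddCommGroup A] [Module R A] [AddCommGroup B] [Module R B] (i : A →ₗ[R] B),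
    Function.Injective i →
    (∀ (M : Type u) [AddCommGroup M] [Module R M], Function.Injective (LinearMap.rTensor M i)) →
    InAdd R X B → ∃ r : B →ₗ[R] A, r ∘ₗ i = LinearMap.id

/-- A concrete model of `Ext¹_R(M, N)`, computed from the canonical free presentation
`0 → S → (M →₀ R) → M → 0` of `M` as `coker (Hom((M →₀ R), N) → Hom(S, N))`. -/
abbrev ext1 (R : Type u) [CommRing R] (M N : Type u) [AddCommGroup M] [Module R M]
    [AddCommGroup N] [Module R N] : Type u :=
  (↥(LinearMap.ker (Finsupp.linearCombination R (id : M → M))) →ₗ[R] N) ⧸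
    LinearMap.range
      (LinearMap.lcomp R N (LinearMap.ker (Finsupp.linearCombination R (id : M → M))).subtype)

/-- A concrete model of `Tor₁^R(M, N)`, computed from the canonical free presentation
`0 → S → (M →₀ R) → M → 0` of `M` as `ker (S ⊗ N → (M →₀ R) ⊗ N)`. -/
abbrev tor1 (R : Type u) [CommRing R] (M N : Type u) [AddCommGroup M] [Module R M]
    [AddCommGroup N] [Module R N] : Type u :=
  ↥(LinearMap.ker
    (LinearMap.rTensor N (LinearMap.ker (Finsupp.linearCombination R (id : M → M))).subtype))

/-- The cokernel `U/R` of a ring map `R → U`. -/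
abbrev cokerAlg (R U : Type u) [CommRing R] [CommRing U] [Algebra R U] : Type u :=
  U ⧸ LinearMap.range (Algebra.linearMap R U)

/-- A linear topology on a commutative ring `R`, given by its filter of open ideals. -/
structure LinearTopologyOn (R : Type u) [CommRing R] : Type u where
  sets : Set (Ideal R)
  top_mem : (⊤ : Ideal R) ∈ sets
  mem_of_le : ∀ {I J : Ideal R}, I ∈ sets → I ≤ J → J ∈ sets
  inf_mem : ∀ {I J : Ideal R}, I ∈ sets → J ∈ sets → I ⊓ J ∈ sets

/-- An `R`-module `M` is `H`-discrete if the annihilator of every element is open. -/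
def LinearTopologyOn.IsDiscrete {R : Type u} [CommRing R] (H : LinearTopologyOn R)
    (M : Type u) [AddCommGroup M] [Module R M] : Prop :=
  ∀ x : M, Ideal.torsionOf R M x ∈ H.sets

/-- `R` is `H`-h-local: every open ideal is contained in only finitely many maximal ideals,
and every open prime ideal is contained in only one maximal ideal. -/
def LinearTopologyOn.IsHLocal {R : Type u} [CommRing R] (H : LinearTopologyOn R) : Prop :=
  (∀ J ∈ H.sets, {m : Ideal R | m.IsMaximal ∧ J ≤ m}.Finite) ∧
  (∀ p ∈ H.sets, p.IsPrime →
    ∀ m n : Ideal R, m.IsMaximal → n.IsMaximal → p ≤ m → p ≤ n → m = n)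

/-- Over `S`, `M` admits a resolution of length `n` by finitely generated projectives. -/
def FGProjDimLE (S : Type u) [CommRing S] :
    ℕ → ∀ (M : Type u) [AddCommGroup M] [Module S M], Prop
  | 0, M, iA, iM =>
      letI := iA; letI := iM
      Module.Finite S M ∧ Module.Projective S M
  | n + 1, M, iA, iM =>
      letI := iA; letI := iM
      ∃ (k : ℕ) (f : (Fin k → S) →ₗ[S] M),
        Function.Surjective f ∧ FGProjDimLE S n ↥(LinearMap.ker f)
namespace GabrielTopology

section Helpers

variable {R : Type u} [CommRing R] {G : GabrielTopology R}

theorem mul_mem {I J : Ideal R} (hI : I ∈ G.sets) (hJ : J ∈ G.sets) : I * J ∈ G.sets := by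
  refine G.gabriel _ J hJ fun r hr => G.mem_of_le hI fun x hx => ?_
  rw [Submodule.mem_colon]
  intro y hy
  obtain ⟨c, rfl⟩ := Ideal.mem_span_singleton'.1 hy
  exact Ideal.mul_mem_mul hx (J.mul_mem_left c hr)

theorem prod_mem {ι : Type*} (s : Finset ι) (I : ι → Ideal R) (h : ∀ i ∈ s, I i ∈ G.sets) :
    ∏ i ∈ s, I i ∈ G.sets :=
  Finset.prod_induction I (· ∈ G.sets) (fun _ _ => mul_mem)
    (by rw [Ideal.one_eq_top]; exact G.top_mem) h

variable (G) in
/-- Divisibility of a module by the finite subsets of `R` that generate an ideal of `G`. -/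
def FinsetDivisible (D : Type u) [AddCommGroup D] [Module R D] : Prop :=
  ∀ s : Finset R, Ideal.span (s : Set R) ∈ G.sets → ∀ d : D, ∃ g : R → D, ∑ r ∈ s, r • g r = d

theorem finsetDivisible_iff (hG : G.FinitelyGenerated) {D : Type u} [AddCommGroup D]
    [Module R D] : G.FinsetDivisible D ↔ G.IsDivisible D := by
  constructor
  · intro h J hJ
    obtain ⟨J', hJ', hle, s, rfl⟩ := hG J hJ
    refine eq_top_iff.2 fun d _ => ?_
    obtain ⟨g, rfl⟩ := h s hJ' d
    exact Submodule.sum_mem _ fun r hr =>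
      Submodule.smul_mem_smul (hle (Ideal.subset_span hr)) trivial
  · intro h s hs d
    have hd : d ∈ Ideal.span (s : Set R) • (⊤ : Submodule R D) := by rw [h _ hs]; trivial
    induction hd using Submodule.smul_induction_on' with
    | smul r hr n _ =>
      obtain ⟨c, -, rfl⟩ := Submodule.mem_span_finset.1 hr
      exact ⟨fun r => c r • n, by simp [Finset.sum_smul, smul_smul, mul_comm]⟩
    | add x _ y _ hx hy =>
      obtain ⟨g, rfl⟩ := hx
      obtain ⟨g', rfl⟩ := hy
      exact ⟨g + g', by simp [Finset.sum_add_distrib]⟩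

theorem FinsetDivisible.congr {D E : Type u} [AddCommGroup D] [Module R D] [AddCommGroup E]
    [Module R E] (h : G.FinsetDivisible D) (e : D ≃ₗ[R] E) : G.FinsetDivisible E := by
  intro s hs d
  obtain ⟨g, hg⟩ := h s hs (e.symm d)
  exact ⟨fun r => e (g r), by simpa using congrArg e hg⟩

/-- Linear maps from a free module to a divisible module form a divisible module. -/
theorem FinsetDivisible.hom {D : Type u} [AddCommGroup D] [Module R D]
    (h : G.FinsetDivisible D) (X : Type u) : G.FinsetDivisible ((X →₀ R) →ₗ[R] D) := by
  intro s hs f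
  choose g hg using fun x : X => h s hs (f (Finsupp.single x 1))
  refine ⟨fun r => Finsupp.lift D R X fun x => g x r, ?_⟩
  ext x
  simpa using hg x

/-- Maps from a module in `𝒜` lift along epimorphisms with divisible kernel. -/
theorem MemA.exists_lift (hG : G.FinitelyGenerated) {A Y X : Type u} [AddCommGroup A]
    [Module R A] [AddCommGroup Y] [Module R Y] [AddCommGroup X] [Module R X] (hA : G.MemA A)
    (p : Y →ₗ[R] X) (hp : Function.Surjective p)
    (hker : G.FinsetDivisible (LinearMap.ker p)) (f : A →ₗ[R] X) :
    ∃ g : A →ₗ[R] Y, p ∘ₗ g = f := by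
  let q : A × Y →ₗ[R] X := f ∘ₗ LinearMap.fst R A Y - p ∘ₗ LinearMap.snd R A Y
  let i : LinearMap.ker p →ₗ[R] LinearMap.ker q :=
    (LinearMap.inr R A Y ∘ₗ (LinearMap.ker p).subtype).codRestrict _ fun k => by simp [q]
  obtain ⟨s, hs⟩ := hA (LinearMap.ker p) ((finsetDivisible_iff hG).1 hker) (LinearMap.ker q) i
    (LinearMap.fst R A Y ∘ₗ (LinearMap.ker q).subtype)
    (fun k k' h => Subtype.ext (congrArg (fun z : LinearMap.ker q => z.1.2) h))
    (fun a => by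
      obtain ⟨y, hy⟩ := hp (f a)
      exact ⟨⟨(a, y), by simp [q, hy]⟩, rfl⟩)
    (by
      ext ⟨⟨a, y⟩, hz⟩
      constructor
      · rintro ⟨k, hk⟩
        have := congrArg (fun z : LinearMap.ker q => z.1.1) hk
        exact this.symm
      · intro ha
        have ha' : a = 0 := ha
        subst ha'
        have hy : p y = 0 := by simpa [q] using hz
        exact ⟨⟨y, hy⟩, rfl⟩)
  refine ⟨LinearMap.snd R A Y ∘ₗ (LinearMap.ker q).subtype ∘ₗ s, ?_⟩
  ext a
  have h₁ : (s a).1.1 = a := LinearMap.congr_fun hs a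
  have h₂ : f (s a).1.1 - p (s a).1.2 = 0 := (s a).2
  rw [h₁, sub_eq_zero] at h₂
  exact h₂.symm

theorem memA_of_exists_lift (hG : G.FinitelyGenerated) {A : Type u} [AddCommGroup A]
    [Module R A]
    (h : ∀ (Y : Type u) [AddCommGroup Y] [Module R Y] (p : Y →ₗ[R] A), Function.Surjective p →
      G.FinsetDivisible (LinearMap.ker p) → ∃ g : A →ₗ[R] Y, p ∘ₗ g = LinearMap.id) :
    G.MemA A := by
  intro D _ _ hD E _ _ i p hi hp hip
  exact h E p hp (((finsetDivisible_iff hG).2 hD).congr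
    ((LinearEquiv.ofInjective i hi).trans (LinearEquiv.ofEq _ _ hip)))

/-- The module obtained from `A` by adjoining elements `e_r`, `r ∈ R`, subject to
`b = ∑ r ∈ s, r • e_r`. -/
abbrev AdjoinQuotient {A : Type u} [AddCommGroup A] [Module R A] (b : A) (s : Finset R) : Type u :=
  (A × (R →₀ R)) ⧸ Submodule.span R {((b, -∑ r ∈ s, Finsupp.single r r) : A × (R →₀ R))}

theorem adjoinQuotient_mkQ {A : Type u} [AddCommGroup A] [Module R A] (b : A) (s : Finset R) :
    (Submodule.span R {((b, -∑ r ∈ s, Finsupp.single r r) : A × (R →₀ R))}).mkQ (b, 0) =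
      ∑ r ∈ s, r • (Submodule.span R {((b, -∑ r ∈ s, Finsupp.single r r) :
        A × (R →₀ R))}).mkQ (0, Finsupp.single r 1) := by
  rw [← sub_eq_zero]
  simp only [← map_smul, ← map_sum, ← map_sub]
  rw [Submodule.mkQ_apply, Submodule.Quotient.mk_eq_zero]
  convert Submodule.mem_span_singleton_self _ using 1
  ext <;> simp [Prod.fst_sum, Prod.snd_sum]

theorem MemA.adjoinQuotient (hG : G.FinitelyGenerated) {A : Type u} [AddCommGroup A]
    [Module R A] (hA : G.MemA A) (b : A) (s : Finset R)
    (hs : Ideal.span (s : Set R) ∈ G.sets) : G.MemA (AdjoinQuotient b s) := by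
  refine memA_of_exists_lift hG fun Y _ _ p hp hker => ?_
  let N := Submodule.span R {((b, -∑ r ∈ s, Finsupp.single r r) : A × (R →₀ R))}
  obtain ⟨g, hg⟩ := hA.exists_lift hG p hp hker (N.mkQ ∘ₗ LinearMap.inl R A (R →₀ R))
  choose z hz using fun r : R => hp (N.mkQ (0, Finsupp.single r 1))
  have hrel : N.mkQ (b, 0) = _ := adjoinQuotient_mkQ b s
  have hk : g b - ∑ r ∈ s, r • z r ∈ LinearMap.ker p := by
    have : p (g b) = N.mkQ (b, 0) := LinearMap.congr_fun hg b
    simp only [LinearMap.mem_ker, map_sub, map_sum, map_smul, hz, this, hrel]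
    exact sub_self _
  obtain ⟨d, hd⟩ := hker s hs ⟨_, hk⟩
  have hd' : ∑ r ∈ s, r • (d r : Y) = g b - ∑ r ∈ s, r • z r := by
    simpa using congrArg (LinearMap.ker p).subtype hd
  let l : A × (R →₀ R) →ₗ[R] Y :=
    g.coprod (Finsupp.lift Y R R fun r => z r + (d r : Y))
  have hl : N ≤ LinearMap.ker l := by
    refine (Submodule.span_singleton_le_iff_mem _ _).2 ?_
    rw [LinearMap.mem_ker, LinearMap.coprod_apply, map_neg, map_sum]
    simp [smul_add, Finset.sum_add_distrib, hd']
  refine ⟨N.liftQ l hl, ?_⟩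
  refine Submodule.linearMap_qext _ (LinearMap.prod_ext ?_ ?_)
  · ext a
    simpa [l] using LinearMap.congr_fun hg a
  · ext r
    have : p (d r) = 0 := (d r).2
    simpa [l, this] using hz r

/-- The kernel of an `𝒜`-cover is divisible. -/
theorem finsetDivisible_ker_of_cover (hG : G.FinitelyGenerated) {M A : Type u} [AddCommGroup M]
    [Module R M] [AddCommGroup A] [Module R A] (φ : A →ₗ[R] M) (hA : G.MemA A)
    (hpre : ∀ (C' : Type u) [AddCommGroup C'] [Module R C'], G.MemA C' →
      ∀ f : C' →ₗ[R] M, ∃ g : C' →ₗ[R] A, φ ∘ₗ g = f)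
    (hcov : ∀ e : A →ₗ[R] A, φ ∘ₗ e = φ → Function.Bijective e) :
    G.FinsetDivisible (LinearMap.ker φ) := by
  intro s hs b
  let N := Submodule.span R {((b, -∑ r ∈ s, Finsupp.single r r) : A × (R →₀ R))}
  have hN : N ≤ LinearMap.ker (φ ∘ₗ LinearMap.fst R A (R →₀ R)) :=
    (Submodule.span_singleton_le_iff_mem _ _).2 (by simp)
  obtain ⟨g, hg⟩ := hpre (AdjoinQuotient (b : A) s) (hA.adjoinQuotient hG _ s hs) (N.liftQ _ hN)
  let e : A →ₗ[R] A := g ∘ₗ N.mkQ ∘ₗ LinearMap.inl R A (R →₀ R)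
  have he : φ ∘ₗ e = φ := by
    ext a
    exact LinearMap.congr_fun hg (N.mkQ (a, 0))
  let e' := LinearEquiv.ofBijective e (hcov e he)
  have he' (a : A) : φ (e'.symm a) = φ a := by
    conv_rhs => rw [← e'.apply_symm_apply a]
    exact (LinearMap.congr_fun he _).symm
  have hrel : N.mkQ ((b : A), 0) = _ := adjoinQuotient_mkQ (b : A) s
  refine ⟨fun r => ⟨e'.symm (g (N.mkQ (0, Finsupp.single r 1))), ?_⟩, ?_⟩
  · rw [LinearMap.mem_ker, he']
    simpa using LinearMap.congr_fun hg (N.mkQ (0, Finsupp.single r 1))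
  · ext
    have : e'.symm (g (N.mkQ ((b : A), 0))) = b := e'.symm_apply_apply (b : A)
    rw [hrel] at this
    simpa using this

/-- A finite family fixed by a matrix of endomorphisms that the cover annihilates is zero. -/
theorem eq_zero_of_eq_sum {M A : Type u} [AddCommGroup M]
    [Module R M] [AddCommGroup A] [Module R A] (φ : A →ₗ[R] M)
    (hcov : ∀ e : A →ₗ[R] A, φ ∘ₗ e = φ → Function.Bijective e) {ι : Type*} [DecidableEq ι]
    (t : Finset ι) (c : ι → A) (h : ι → ι → A →ₗ[R] A) (hφ : ∀ i j a, φ (h i j a) = 0)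
    (hc : ∀ i ∈ t, c i = ∑ j ∈ t, h i j (c j)) : ∀ i ∈ t, c i = 0 := by
  induction t using Finset.induction_on generalizing h with
  | empty => simp
  | insert k t hk ih =>
    let e : A →ₗ[R] A := LinearMap.id - h k k
    have he : φ ∘ₗ e = φ := by ext a; simp [e, hφ]
    let e' := LinearEquiv.ofBijective e (hcov e he)
    have hck : c k = e'.symm (∑ j ∈ t, h k j (c j)) := by
      rw [LinearEquiv.eq_symm_apply]
      have := hc k (Finset.mem_insert_self k t)
      rw [Finset.sum_insert hk] at this
      change c k - h k k (c k) = _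
      rw [sub_eq_iff_eq_add']
      exact this
    have hzero := ih (fun i j => h i j + h i k ∘ₗ e'.symm.toLinearMap ∘ₗ h k j)
      (fun i j a => by simp [hφ]) fun i hi => by
        have := hc i (Finset.mem_insert_of_mem hi)
        rw [Finset.sum_insert hk, hck, map_sum, map_sum] at this
        rw [this]
        simp [Finset.sum_add_distrib, add_comm]
    intro i hi
    rcases Finset.mem_insert.1 hi with rfl | hi
    · rw [hck, Finset.sum_eq_zero fun j hj => by rw [hzero j hj, map_zero], map_zero]
    · exact hzero i hi

variable (G) in
/-- The finite subsets of `R` that generate an ideal of `G`. -/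
abbrev Gen : Type u := {s : Finset R // Ideal.span (s : Set R) ∈ G.sets}

variable (G) in
/-- Words indexing the generators of the module obtained from `R` by freely making each
generator divisible: `w = ∑ r ∈ s, r • ((s, r) :: w)` for every `s`. -/
abbrev Word : Type u := List (G.Gen × R)

variable (G) in
/-- The relations making the words with coefficients in `X` divisible. -/
noncomputable def divRel (X : Type u) [AddCommGroup X] [Module R X] : Submodule R (G.Word →₀ X) :=
  Submodule.span R {z | ∃ (s : G.Gen) (u : G.Word →₀ X),
    z = u - ∑ r ∈ s.1, r • u.mapDomain (List.cons (s, r))}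

theorem sub_mem_divRel {X : Type u} [AddCommGroup X] [Module R X] (s : G.Gen)
    (u : G.Word →₀ X) :
    u - ∑ r ∈ s.1, r • u.mapDomain (List.cons (s, r)) ∈ G.divRel X :=
  Submodule.subset_span ⟨s, u, rfl⟩

theorem map_divRel {X Z : Type u} [AddCommGroup X] [Module R X] [AddCommGroup Z] [Module R Z]
    (f : X →ₗ[R] Z) (hf : Function.Surjective f) :
    (G.divRel X).map (Finsupp.mapRange.linearMap f) = G.divRel Z := by
  have key (s : G.Gen) (u : G.Word →₀ X) : Finsupp.mapRange.linearMap f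
      (u - ∑ r ∈ s.1, r • u.mapDomain (List.cons (s, r))) =
      Finsupp.mapRange.linearMap f u -
        ∑ r ∈ s.1, r • (Finsupp.mapRange.linearMap f u).mapDomain (List.cons (s, r)) := by
    rw [map_sub, map_sum]
    congr 1
    refine Finset.sum_congr rfl fun r _ => ?_
    rw [map_smul]
    congr 1
    exact (Finsupp.mapDomain_mapRange _ _ _ f.map_zero f.map_add).symm
  have hsurj : Function.Surjective (Finsupp.mapRange.linearMap (α := G.Word) f) :=
    Finsupp.mapRange_surjective f f.map_zero hf
  rw [divRel, divRel, Submodule.map_span]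
  congr 1
  ext z
  constructor
  · rintro ⟨_, ⟨s, u, rfl⟩, rfl⟩
    exact ⟨s, _, key s u⟩
  · rintro ⟨s, u, rfl⟩
    obtain ⟨u, rfl⟩ := hsurj u
    exact ⟨_, ⟨s, u, rfl⟩, key s u⟩

/-- The map of free divisible modules induced by an epimorphism has divisible kernel. -/
theorem finsetDivisible_ker_mapQ {X Z : Type u} [AddCommGroup X] [Module R X] [AddCommGroup Z]
    [Module R Z] (f : X →ₗ[R] Z) (hf : Function.Surjective f) :
    G.FinsetDivisible (LinearMap.ker ((G.divRel X).mapQ (G.divRel Z)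
      (Finsupp.mapRange.linearMap f) (Submodule.map_le_iff_le_comap.1 (map_divRel f hf).le))) := by
  rintro s hs ⟨y, hy⟩
  obtain ⟨u, rfl⟩ := (G.divRel X).mkQ_surjective y
  have hu : Finsupp.mapRange.linearMap f u ∈ G.divRel Z := by
    simpa using hy
  rw [← map_divRel f hf] at hu
  obtain ⟨n, hn, hnu⟩ := hu
  have hmap (r : R) : Finsupp.mapRange.linearMap f
      ((u - n).mapDomain (List.cons ((⟨s, hs⟩ : G.Gen), r))) = 0 := by
    have h₀ : Finsupp.mapRange.linearMap f (u - n) = 0 := by rw [map_sub, hnu, sub_self]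
    have h₁ := Finsupp.mapDomain_mapRange (List.cons ((⟨s, hs⟩ : G.Gen), r)) (u - n) f
      f.map_zero f.map_add
    exact h₁.symm.trans ((congrArg _ h₀).trans Finsupp.mapDomain_zero)
  refine ⟨fun r => ⟨(G.divRel X).mkQ ((u - n).mapDomain (List.cons ((⟨s, hs⟩ : G.Gen), r))), ?_⟩,
    ?_⟩
  · rw [LinearMap.mem_ker, Submodule.mkQ_apply, Submodule.mapQ_apply, hmap]
    exact (Submodule.Quotient.mk_eq_zero _).2 (zero_mem _)
  · ext
    have h := sub_mem_divRel (⟨s, hs⟩ : G.Gen) (u - n)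
    simp only [AddSubmonoidClass.coe_finsetSum, Submodule.coe_smul, ← map_smul, ← map_sum]
    refine ((Submodule.Quotient.eq (G.divRel X)).2 ?_)
    have := (G.divRel X).neg_mem ((G.divRel X).add_mem h hn)
    convert this using 1
    abel

/-- A function on words satisfying the divisibility relations listed in `E`. -/
def IsWeight (E : Finset (G.Word × G.Gen)) (ρ : G.Word → R) : Prop :=
  ∀ q ∈ E, ρ q.1 = ∑ r ∈ q.2.1, r * ρ ((q.2, r) :: q.1)

theorem IsWeight.mono {E E' : Finset (G.Word × G.Gen)} (h : E ⊆ E') {ρ : G.Word → R}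
    (hρ : IsWeight E' ρ) : IsWeight E ρ := fun q hq => hρ q (h hq)

/-- Evaluation of words at a weight. -/
noncomputable def evalWord (ρ : G.Word → R) (X : Type u) [AddCommGroup X] [Module R X] :
    (G.Word →₀ X) →ₗ[R] X :=
  Finsupp.lsum R fun w => ρ w • LinearMap.id

theorem evalWord_single (ρ : G.Word → R) {X : Type u} [AddCommGroup X] [Module R X]
    (w : G.Word) (x : X) : evalWord ρ X (Finsupp.single w x) = ρ w • x := by
  simp [evalWord]

theorem evalWord_mapRange (ρ : G.Word → R) {X Z : Type u} [AddCommGroup X] [Module R X]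
    [AddCommGroup Z] [Module R Z] (f : X →ₗ[R] Z) (u : G.Word →₀ X) :
    evalWord ρ Z (Finsupp.mapRange.linearMap f u) = f (evalWord ρ X u) := by
  induction u using Finsupp.induction_linear with
  | zero => simp
  | add u v hu hv => simp only [map_add, hu, hv]
  | single w x => simp [evalWord_single]

open Classical in
theorem exists_evalWord_eq_zero {X : Type u} [AddCommGroup X] [Module R X] {z : G.Word →₀ X}
    (hz : z ∈ G.divRel X) :
    ∃ E : Finset (G.Word × G.Gen), ∀ ρ, IsWeight E ρ → evalWord ρ X z = 0 := by
  induction hz using Submodule.span_induction with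
  | zero => exact ⟨∅, by simp⟩
  | add x y _ _ hx hy =>
    obtain ⟨E, hE⟩ := hx
    obtain ⟨E', hE'⟩ := hy
    exact ⟨E ∪ E', fun ρ hρ => by
      rw [map_add, hE ρ (hρ.mono Finset.subset_union_left),
        hE' ρ (hρ.mono Finset.subset_union_right), add_zero]⟩
  | smul c x _ hx =>
    obtain ⟨E, hE⟩ := hx
    exact ⟨E, fun ρ hρ => by rw [map_smul, hE ρ hρ, smul_zero]⟩
  | mem x hx =>
    obtain ⟨s, u, rfl⟩ := hx
    induction u using Finsupp.induction_linear with
    | zero => exact ⟨∅, by simp⟩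
    | add u v hu hv =>
      obtain ⟨E, hE⟩ := hu
      obtain ⟨E', hE'⟩ := hv
      refine ⟨E ∪ E', fun ρ hρ => ?_⟩
      have h₁ := hE ρ (hρ.mono Finset.subset_union_left)
      have h₂ := hE' ρ (hρ.mono Finset.subset_union_right)
      simp only [Finsupp.mapDomain_add, smul_add, Finset.sum_add_distrib, map_add, map_sub]
        at h₁ h₂ ⊢
      rw [add_sub_add_comm, h₁, h₂, add_zero]
    | single w x =>
      refine ⟨{(w, s)}, fun ρ hρ => ?_⟩
      have := hρ (w, s) (Finset.mem_singleton_self _)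
      simp only [Finsupp.mapDomain_single, map_sub, map_sum, map_smul, evalWord_single]
      rw [this, Finset.sum_smul, sub_eq_zero]
      simp only [smul_smul]

open Classical in
/-- The division steps leading to a word. -/
noncomputable def steps : G.Word → Finset (G.Word × G.Gen)
  | [] => ∅
  | q :: w => insert (w, q.1) (steps w)

open Classical in
theorem length_lt_of_mem_steps {w : G.Word} {q : G.Word × G.Gen} (hq : q ∈ steps w) :
    q.1.length < w.length := by
  induction w with
  | nil => simp [steps] at hq
  | cons l w ih =>
    rw [steps, Finset.mem_insert] at hq
    rcases hq with rfl | hq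
    · simp
    · have := ih hq
      simp only [List.length_cons]
      omega

/-- A word all of whose letters are those selected by `κ`. -/
def Follows (κ : G.Word × G.Gen → R) : G.Word → Prop
  | [] => True
  | q :: w => q.2 = κ (w, q.1) ∧ Follows κ w

open Classical in
theorem exists_isWeight (E : Finset (G.Word × G.Gen)) (x : R)
    (hx : x ∈ ∏ q ∈ E, Ideal.span (q.2.1 : Set R)) :
    ∃ ρ, IsWeight E ρ ∧ ρ [] = x := by
  rw [Ideal.prod_span] at hx
  induction hx using Submodule.span_induction with
  | zero => exact ⟨0, fun q _ => by simp, rfl⟩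
  | add x y _ _ hx hy =>
    obtain ⟨ρ, hρ, rfl⟩ := hx
    obtain ⟨ρ', hρ', rfl⟩ := hy
    exact ⟨ρ + ρ', fun q hq => by
      simp [hρ q hq, hρ' q hq, mul_add, Finset.sum_add_distrib], rfl⟩
  | smul c x _ hx =>
    obtain ⟨ρ, hρ, rfl⟩ := hx
    exact ⟨c • ρ, fun q hq => by
      simp [hρ q hq, Finset.mul_sum, mul_left_comm], rfl⟩
  | mem x hx =>
    obtain ⟨κ, hκ, rfl⟩ := (Set.mem_finsetProd _ _ _).1 hx
    refine ⟨fun w => if Follows κ w then ∏ q ∈ E \ steps w, κ q else 0, ?_, by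
      simp [Follows, steps]⟩
    rintro ⟨w, s⟩ hq
    by_cases hw : Follows κ w
    · have hnot : (w, s) ∉ steps w := fun h => lt_irrefl _ (length_lt_of_mem_steps h)
      rw [Finset.sum_eq_single_of_mem (κ (w, s)) (hκ hq)
        fun r _ hr => by simp [Follows, hr]]
      simp only [Follows, hw, and_self, if_true, steps]
      rw [Finset.sdiff_insert, Finset.mul_prod_erase _ _ (Finset.mem_sdiff.2 ⟨hq, hnot⟩)]
    · simp [Follows, hw]

open Classical in
theorem exists_divisible_family {H : Type u} [AddCommGroup H] [Module R H]
    (hH : G.FinsetDivisible H) {E : Finset (G.Word × G.Gen)} {ρ : G.Word → R}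
    (hρ : IsWeight E ρ) (θ : H) :
    ∃ P : G.Word → H, (∀ (s : G.Gen) (w : G.Word), ∑ r ∈ s.1, r • P ((s, r) :: w) = P w) ∧
      ∀ w, steps w ⊆ E → P w = ρ w • θ := by
  have key (w : G.Word) (s : G.Gen) (d : H) : ∃ g : R → H, ∑ r ∈ s.1, r • g r = d ∧
      ((w, s) ∈ E → d = ρ w • θ → ∀ r, g r = ρ ((s, r) :: w) • θ) := by
    by_cases h : (w, s) ∈ E ∧ d = ρ w • θ
    · refine ⟨fun r => ρ ((s, r) :: w) • θ, ?_, fun _ _ _ => rfl⟩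
      rw [h.2, hρ _ h.1, Finset.sum_smul]
      simp only [smul_smul]
    · obtain ⟨g, hg⟩ := hH s.1 s.2 d
      exact ⟨g, hg, fun h₁ h₂ => (h ⟨h₁, h₂⟩).elim⟩
  choose g hg hgE using key
  let P : G.Word → H := fun w => List.rec (ρ [] • θ) (fun q w d => g w q.1 d q.2) w
  refine ⟨P, fun s w => hg w s (P w), fun w => ?_⟩
  induction w with
  | nil => exact fun _ => rfl
  | cons q w ih =>
    intro h
    rw [steps, Finset.insert_subset_iff] at h
    exact hgE w q.1 (P w) h.1 (ih h.2) q.2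

open Classical in
/-- Every element of a module of `𝒜` becomes, up to `G`, a value of a map from a free module
in such a way that maps from that free module to divisible modules can be realised on the
element by maps defined on the whole module. -/
theorem MemA.exists_ideal (hG : G.FinitelyGenerated) {A : Type u} [AddCommGroup A] [Module R A]
    (hA : G.MemA A) (a : A) : ∃ I ∈ G.sets, ∀ x ∈ I, ∃ v : A →₀ R,
      Finsupp.linearCombination R id v = x • a ∧
      ∀ (D : Type u) [AddCommGroup D] [Module R D], G.FinsetDivisible D →
        ∀ Θ : (A →₀ R) →ₗ[R] D, ∃ h : A →ₗ[R] D, h a = Θ v := by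
  let π : (A →₀ R) →ₗ[R] A := Finsupp.linearCombination R id
  have hπ : Function.Surjective π := Finsupp.linearCombination_id_surjective R A
  obtain ⟨σ, hσ⟩ := hA.exists_lift hG _
    (by
      rw [← LinearMap.range_eq_top, Submodule.range_mapQ, LinearMap.range_eq_top.2
        (Finsupp.mapRange_surjective π π.map_zero hπ), Submodule.map_top, Submodule.range_mkQ])
    (finsetDivisible_ker_mapQ (G := G) π hπ)
    ((G.divRel A).mkQ ∘ₗ Finsupp.lsingle [])
  obtain ⟨u, hu⟩ := (G.divRel (A →₀ R)).mkQ_surjective (σ a)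
  have hua : Finsupp.mapRange.linearMap π u - Finsupp.single [] a ∈ G.divRel A := by
    rw [← Submodule.Quotient.eq]
    have := LinearMap.congr_fun hσ a
    rw [LinearMap.comp_apply, ← hu] at this
    exact this
  obtain ⟨E₀, hE₀⟩ := exists_evalWord_eq_zero hua
  let E := E₀ ∪ u.support.biUnion steps
  refine ⟨∏ q ∈ E, Ideal.span (q.2.1 : Set R), prod_mem _ _ fun q _ => q.2.2, fun x hx => ?_⟩
  obtain ⟨ρ, hρ, rfl⟩ := exists_isWeight E x hx
  refine ⟨evalWord ρ _ u, ?_, fun D _ _ hD Θ => ?_⟩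
  · have := hE₀ ρ (hρ.mono Finset.subset_union_left)
    rw [map_sub, evalWord_mapRange, evalWord_single, sub_eq_zero] at this
    exact this
  · obtain ⟨P, hP, hPρ⟩ := exists_divisible_family (hD.hom A) hρ Θ
    let l : (G.Word →₀ (A →₀ R)) →ₗ[R] D := Finsupp.lsum R P
    have hl : G.divRel (A →₀ R) ≤ LinearMap.ker l := by
      refine Submodule.span_le.2 ?_
      rintro _ ⟨s, u, rfl⟩
      rw [SetLike.mem_coe, LinearMap.mem_ker]
      induction u using Finsupp.induction_linear with
      | zero => simp
      | add u v hu hv =>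
        simp only [Finsupp.mapDomain_add, smul_add, Finset.sum_add_distrib, map_add, map_sub]
          at hu hv ⊢
        rw [add_sub_add_comm, hu, hv, add_zero]
      | single w x =>
        simp only [Finsupp.mapDomain_single, map_sub, map_sum, map_smul, l, Finsupp.lsum_single]
        rw [sub_eq_zero, ← hP s w]
        simp
    refine ⟨(G.divRel (A →₀ R)).liftQ l hl ∘ₗ σ, ?_⟩
    rw [LinearMap.comp_apply, ← hu, Submodule.mkQ_apply, Submodule.liftQ_apply]
    change u.sum (fun w v => P w v) = Θ (u.sum fun w v => (ρ w • LinearMap.id) v)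
    rw [map_finsuppSum]
    refine Finset.sum_congr rfl fun w hw => ?_
    have hw' : steps w ⊆ E :=
      (Finset.subset_biUnion_of_mem steps hw).trans Finset.subset_union_right
    simp [hPρ w hw']

end Helpers

end GabrielTopology

theorem stmt5 (R : Type u) [CommRing R] (G : GabrielTopology R) (hG : G.IsTiltingTopology)
    (M : Type u) [AddCommGroup M] [Module R M]
    (J : Ideal R) (hJ : J ∈ G.sets) (hJfg : J.FG) (hJM : J • (⊤ : Submodule R M) = ⊥)
    (A : Type u) [AddCommGroup A] [Module R A] (φ : A →ₗ[R] M)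
    (hsurj : Function.Surjective φ) (hA : G.MemA A)
    (hpre : ∀ (C' : Type u) [AddCommGroup C'] [Module R C'], G.MemA C' →
      ∀ f : C' →ₗ[R] M, ∃ g : C' →ₗ[R] A, φ ∘ₗ g = f)
    (hcov : ∀ e : A →ₗ[R] A, φ ∘ₗ e = φ → Function.Bijective e) :
    G.IsTorsion A ∧ G.IsTorsion ↥(LinearMap.ker φ) := by
  classical
  obtain ⟨-, hfg, -⟩ := hG
  have hB := GabrielTopology.finsetDivisible_ker_of_cover hfg φ hA hpre hcov
  have hJA : ∀ x ∈ J, ∀ a : A, φ (x • a) = 0 := fun x hx a => by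
    rw [map_smul, ← Submodule.mem_bot R, ← hJM]
    exact Submodule.smul_mem_smul hx trivial
  have htor : G.IsTorsion A := by
    intro a
    obtain ⟨I, hI, hIa⟩ := hA.exists_ideal hfg a
    obtain ⟨_, ht, hle, t, rfl⟩ := hfg _ (G.inf_mem hI hJ)
    have hat (x : R) (hx : x ∈ t) := hle (Ideal.subset_span (Finset.mem_coe.2 hx))
    let π : (A →₀ R) →ₗ[R] A := Finsupp.linearCombination R id
    have key (i : R × R) : ∃ h : R × R → A →ₗ[R] A, (∀ j b, φ (h j b) = 0) ∧
        (i ∈ t ×ˢ t → (i.1 * i.2) • a = ∑ j ∈ t ×ˢ t, h j ((j.1 * j.2) • a)) := by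
      by_cases hi : i ∈ t ×ˢ t
      swap
      · exact ⟨0, by simp, fun h => (hi h).elim⟩
      obtain ⟨hi₁, hi₂⟩ := Finset.mem_product.1 hi
      obtain ⟨v, hv, hvD⟩ := hIa i.2 (hat _ hi₂).1
      let f : (A →₀ R) →ₗ[R] LinearMap.ker φ :=
        (i.1 • π).codRestrict _ fun u => hJA _ (hat _ hi₁).2 (π u)
      obtain ⟨g, hg⟩ := hB.hom A t ht f
      choose g' hg' using fun r => hB.hom A t ht (g r)
      choose h hh using fun j : R × R => hvD _ hB (g' j.1 j.2)
      refine ⟨fun j => (LinearMap.ker φ).subtype ∘ₗ h j, fun j b => (h j b).2, fun _ => ?_⟩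
      have hfv : (f v : A) = (i.1 * i.2) • a := by
        rw [mul_smul, ← hv]
        rfl
      rw [← hfv, ← hg]
      simp only [← hg', Finset.sum_product, LinearMap.coe_sum, Finset.sum_apply,
        LinearMap.smul_apply, LinearMap.comp_apply, map_smul, hh, Finset.smul_sum, smul_smul,
        AddSubmonoidClass.coe_finsetSum, Submodule.coe_smul, Submodule.coe_subtype]
    choose h hφ hc using key
    have hzero := GabrielTopology.eq_zero_of_eq_sum φ hcov (t ×ˢ t)
      (fun i => (i.1 * i.2) • a) h hφ hc
    refine G.mem_of_le (GabrielTopology.mul_mem ht ht) ?_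
    rw [Ideal.span_mul_span', Ideal.span_le]
    rintro _ ⟨x, hx, y, hy, rfl⟩
    exact hzero (x, y) (Finset.mem_product.2 ⟨hx, hy⟩)
  refine ⟨htor, fun b => G.mem_of_le (htor b) fun r hr => ?_⟩
  rw [Ideal.mem_torsionOf_iff] at hr ⊢
  exact Subtype.ext hr
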